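/- For every integer k ≥ 5 and every s ≥ 0, the set C̃_k(β^s) is a Cantor set whose thickness satisfies τ(C̃_k(β^s)) > 1, where β^s is the word (1,k) repeated s times (the empty word when s = 0). -/

import Mathlib

open Filter Set
open scoped Pointwise

noncomputable section

/-- The `n`-th convergent of the continued fraction `[0; a 0, a 1, a 2, …]`. -/
def cfConv : ℕ → (ℕ → ℕ) → ℝ
  | 0, _ => 0
  | n + 1, a => 1 / (a 0 + cfConv n fun i => a (i + 1))

/-- The value `[0; a 0, a 1, a 2, …]` of the infinite continued fraction with
partial quotients `a 0, a 1, …` (the limit of its convergents). -/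
def cfVal (a : ℕ → ℕ) : ℝ := limUnder atTop fun n => cfConv n a

/-- The sequence of partial quotients obtained by concatenating the finite word `b`
with the sequence `θ`. -/
def app (b : List ℕ) (θ : ℕ → ℕ) : ℕ → ℕ := fun n =>
  if h : n < b.length then b.get ⟨n, h⟩ else θ (n - b.length)

/-- `C_k(w) = {[0; w, θ] : θ_n ∈ {1,…,k-1} for all n}`. -/
def Ck (k : ℕ) (w : List ℕ) : Set ℝ :=
  {x | ∃ θ : ℕ → ℕ, (∀ n, 1 ≤ θ n ∧ θ n ≤ k - 1) ∧ x = cfVal (app w θ)}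

/-- `C̃_k(w)`: those `[0; w, θ]` with `θ_n ∈ {1,…,k-1}` and `(θ_1, θ_2) ≠ (1, k-1)`. -/
def Ctilk (k : ℕ) (w : List ℕ) : Set ℝ :=
  {x | ∃ θ : ℕ → ℕ, (∀ n, 1 ≤ θ n ∧ θ n ≤ k - 1) ∧ (θ 0, θ 1) ≠ (1, k - 1) ∧
    x = cfVal (app w θ)}

/-- The word `β^s = (1,k)_s` (the empty word when `s = 0`). -/
def betaW (k s : ℕ) : List ℕ := (List.replicate s [1, k]).flatten

/-- The word `γ^s = (1,k)_{s-1}, 1, k-1`. -/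
def gammaW (k s : ℕ) : List ℕ := betaW k (s - 1) ++ [1, k - 1]

/-- `Ioo a b` is a bounded gap of the compact set `K`: a bounded connected
component of `ℝ \ K`. -/
def IsGap (K : Set ℝ) (a b : ℝ) : Prop :=
  a < b ∧ a ∈ K ∧ b ∈ K ∧ Set.Ioo a b ∩ K = ∅

/-- The length of the left bridge of the gap `Ioo a b` of `K`: the length of the
closed interval between the gap and the nearest gap to its left of length at least
`b - a` (the unbounded gap `(-∞, sInf K)`, of infinite length, always qualifying). -/
def leftBridgeLen (K : Set ℝ) (a b : ℝ) : ℝ :=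
  a - sSup ({sInf K} ∪ {d | ∃ c, IsGap K c d ∧ d ≤ a ∧ b - a ≤ d - c})

/-- The length of the right bridge of the gap `Ioo a b` of `K`. -/
def rightBridgeLen (K : Set ℝ) (a b : ℝ) : ℝ :=
  sInf ({sSup K} ∪ {c | ∃ d, IsGap K c d ∧ b ≤ c ∧ b - a ≤ d - c}) - b

/-- The thickness of `K`: the infimum over bounded gaps `U` of
`min (|L_U|, |R_U|) / |U|`. -/
def thickness (K : Set ℝ) : ℝ :=
  sInf {r | ∃ a b, IsGap K a b ∧
    r = min (leftBridgeLen K a b) (rightBridgeLen K a b) / (b - a)}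

/-- A Cantor set: a compact, perfect, totally disconnected subset of `ℝ`. -/
def IsCantorSet (K : Set ℝ) : Prop :=
  IsCompact K ∧ Perfect K ∧ IsTotallyDisconnected K

/-- All terms of `a` lie in `{1, …, k}`. -/
def Digits (k : ℕ) (a : ℕ → ℕ) : Prop := ∀ n, 1 ≤ a n ∧ a n ≤ k

theorem Digits.shift {k : ℕ} {a : ℕ → ℕ} (h : Digits k a) (n : ℕ) :
    Digits k fun i => a (i + n) := fun i => h (i + n)

theorem Digits.mono {k l : ℕ} {a : ℕ → ℕ} (h : Digits k a) (hkl : k ≤ l) : Digits l a :=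
  fun i => ⟨(h i).1, (h i).2.trans hkl⟩

theorem Digits.one_le_cast {k : ℕ} {a : ℕ → ℕ} (h : Digits k a) (n : ℕ) : (1 : ℝ) ≤ a n := by
  exact_mod_cast (h n).1

theorem Digits.cast_le {k : ℕ} {a : ℕ → ℕ} (h : Digits k a) (n : ℕ) : (a n : ℝ) ≤ k := by
  exact_mod_cast (h n).2

/-- A contraction factor for the maps `x ↦ 1 / (d + x)` on `[1 / (k + 1), 1]`. -/
def contr (k : ℕ) : ℝ := 1 / (1 + 1 / ((k : ℝ) + 1))

theorem contr_nonneg (k : ℕ) : 0 ≤ contr k := by unfold contr; positivity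

theorem contr_lt_one (k : ℕ) : contr k < 1 := by
  unfold contr
  have : (0 : ℝ) < 1 / ((k : ℝ) + 1) := by positivity
  rw [div_lt_one (by positivity)]
  linarith

theorem abs_inv_sub_le (k : ℕ) {d x y : ℝ} (hd : 1 ≤ d) (hx : 0 ≤ x)
    (hy : 1 / ((k : ℝ) + 1) ≤ y) : |1 / (d + x) - 1 / (d + y)| ≤ contr k * |x - y| := by
  have h0 : (0 : ℝ) < 1 / ((k : ℝ) + 1) := by positivity
  have hdx : 0 < d + x := by linarith
  have hdy : 0 < d + y := by linarith
  have e : 1 / (d + x) - 1 / (d + y) = (y - x) * (1 / ((d + x) * (d + y))) := by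
    field_simp
    ring
  rw [e, abs_mul, abs_sub_comm y x, mul_comm,
    abs_of_pos (by positivity : 0 < 1 / ((d + x) * (d + y)))]
  refine mul_le_mul_of_nonneg_right ?_ (abs_nonneg _)
  unfold contr
  refine one_div_le_one_div_of_le (by linarith) ?_
  nlinarith [mul_nonneg (by linarith : 0 ≤ d + x - 1) hdy.le]

theorem cfConv_nonneg (n : ℕ) (a : ℕ → ℕ) : 0 ≤ cfConv n a := by
  induction n generalizing a with
  | zero => simp [cfConv]
  | succ n ih =>
    have := ih fun i => a (i + 1)
    simp only [cfConv]
    positivity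

theorem cfConv_le_one {k : ℕ} (n : ℕ) {a : ℕ → ℕ} (ha : Digits k a) : cfConv n a ≤ 1 := by
  cases n with
  | zero => simp [cfConv]
  | succ n =>
    have h1 := cfConv_nonneg n fun i => a (i + 1)
    have h2 := ha.one_le_cast 0
    simp only [cfConv]
    rw [div_le_one (by linarith)]
    linarith

theorem le_cfConv_succ {k : ℕ} (n : ℕ) {a : ℕ → ℕ} (ha : Digits k a) :
    1 / ((k : ℝ) + 1) ≤ cfConv (n + 1) a := by
  have h1 := cfConv_nonneg n fun i => a (i + 1)
  have h2 := ha.one_le_cast 0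
  have h3 := ha.cast_le 0
  have h4 := cfConv_le_one n (ha.shift 1)
  simp only [cfConv]
  exact one_div_le_one_div_of_le (by linarith) (by linarith)

theorem abs_cfConv_sub_succ_le {k : ℕ} (n : ℕ) {a : ℕ → ℕ} (ha : Digits k a) :
    |cfConv n a - cfConv (n + 1) a| ≤ contr k ^ n := by
  induction n generalizing a with
  | zero =>
    have h1 := cfConv_nonneg 1 a
    have h2 := cfConv_le_one 1 ha
    simp only [show cfConv 0 a = 0 from rfl, pow_zero, zero_add]
    rw [abs_le]
    constructor <;> linarith
  | succ n ih =>
    have h := abs_inv_sub_le k (ha.one_le_cast 0) (cfConv_nonneg n fun i => a (i + 1))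
      (le_cfConv_succ n (ha.shift 1))
    rw [pow_succ']
    exact h.trans (mul_le_mul_of_nonneg_left (ih (ha.shift 1)) (contr_nonneg k))

theorem tendsto_cfConv {k : ℕ} {a : ℕ → ℕ} (ha : Digits k a) :
    Tendsto (fun n => cfConv n a) atTop (nhds (cfVal a)) := by
  have hc : CauchySeq fun n => cfConv n a :=
    cauchySeq_of_le_geometric (contr k) 1 (contr_lt_one k) fun n => by
      rw [Real.dist_eq, one_mul]
      exact abs_cfConv_sub_succ_le n ha
  exact tendsto_nhds_limUnder (cauchySeq_tendsto_of_complete hc)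

theorem le_cfVal {k : ℕ} {a : ℕ → ℕ} (ha : Digits k a) : 1 / ((k : ℝ) + 1) ≤ cfVal a :=
  ge_of_tendsto' ((tendsto_add_atTop_iff_nat 1).2 (tendsto_cfConv ha))
    fun n => le_cfConv_succ n ha

theorem cfVal_pos {k : ℕ} {a : ℕ → ℕ} (ha : Digits k a) : 0 < cfVal a :=
  lt_of_lt_of_le (by positivity) (le_cfVal ha)

theorem cfVal_eq {k : ℕ} {a : ℕ → ℕ} (ha : Digits k a) :
    cfVal a = 1 / (a 0 + cfVal fun i => a (i + 1)) := by
  have h0 := cfVal_pos (ha.shift 1)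
  have h1 := (tendsto_add_atTop_iff_nat 1).2 (tendsto_cfConv ha)
  refine tendsto_nhds_unique h1 ?_
  simp only [cfConv]
  refine tendsto_const_nhds.div (tendsto_const_nhds.add (tendsto_cfConv (ha.shift 1))) ?_
  positivity

theorem cfVal_lt_one {k : ℕ} {a : ℕ → ℕ} (ha : Digits k a) : cfVal a < 1 := by
  have h0 := cfVal_pos (ha.shift 1)
  have h1 := ha.one_le_cast 0
  rw [cfVal_eq ha, div_lt_one (by linarith)]
  linarith

theorem abs_cfVal_sub_le {k : ℕ} (n : ℕ) {a b : ℕ → ℕ} (ha : Digits k a) (hb : Digits k b)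
    (hab : ∀ i < n, a i = b i) : |cfVal a - cfVal b| ≤ contr k ^ n := by
  induction n generalizing a b with
  | zero =>
    rw [pow_zero, abs_le]
    constructor <;> linarith [cfVal_pos ha, cfVal_pos hb, cfVal_lt_one ha, cfVal_lt_one hb]
  | succ n ih =>
    have h := abs_inv_sub_le k (ha.one_le_cast 0) (cfVal_pos (ha.shift 1)).le
      (le_cfVal (hb.shift 1))
    rw [cfVal_eq ha, cfVal_eq hb, ← hab 0 n.succ_pos, pow_succ']
    exact h.trans (mul_le_mul_of_nonneg_left
      (ih (ha.shift 1) (hb.shift 1) fun i hi => hab (i + 1) (by omega)) (contr_nonneg k))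

/-- Prescribing the first `n` partial quotients makes the value a unimodular Möbius function of
the remaining tail. -/
theorem exists_mobius {k : ℕ} (n : ℕ) {a : ℕ → ℕ} (ha : Digits k a) :
    ∃ P P' Q Q' : ℝ, 0 ≤ P ∧ 0 ≤ P' ∧ 0 < Q ∧ 0 ≤ Q' ∧
      (P' * Q - P * Q' = 1 ∨ P' * Q - P * Q' = -1) ∧
      ∀ c, Digits k c → (∀ i < n, c i = a i) →
        cfVal c = (P + P' * cfVal fun i => c (i + n)) / (Q + Q' * cfVal fun i => c (i + n)) := by
  induction n generalizing a with
  | zero => exact ⟨0, 1, 1, 0, by norm_num, by norm_num, by norm_num, le_rfl, by norm_num, by simp⟩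
  | succ n ih =>
    obtain ⟨P, P', Q, Q', hP, hP', hQ, hQ', hdet, h⟩ := ih (ha.shift 1)
    have hd := ha.one_le_cast 0
    refine ⟨Q, Q', a 0 * Q + P, a 0 * Q' + P', hQ.le, hQ', by positivity, by positivity, ?_, ?_⟩
    · rcases hdet with e | e
      · right; linear_combination -e
      · left; linear_combination -e
    · intro c hc hca
      have hx := cfVal_pos (hc.shift (n + 1))
      have h1 := h _ (hc.shift 1) fun i hi => hca (i + 1) (by omega)
      have e : (fun i => c (i + n + 1)) = fun i => c (i + (n + 1)) := rfl
      rw [e] at h1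
      rw [cfVal_eq hc, h1, hca 0 n.succ_pos]
      field_simp
      ring

/-- The number `[a n; a (n+1), a (n+2), …]`. -/
def cfTail (n : ℕ) (a : ℕ → ℕ) : ℝ := a n + cfVal fun i => a (i + (n + 1))

theorem lt_cfTail {k : ℕ} {a : ℕ → ℕ} (ha : Digits k a) (n : ℕ) : (a n : ℝ) < cfTail n a := by
  have := cfVal_pos (ha.shift (n + 1))
  unfold cfTail
  linarith

theorem cfTail_lt {k : ℕ} {a : ℕ → ℕ} (ha : Digits k a) (n : ℕ) : cfTail n a < a n + 1 := by
  have := cfVal_lt_one (ha.shift (n + 1))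
  unfold cfTail
  linarith

theorem cfTail_pos {k : ℕ} {a : ℕ → ℕ} (ha : Digits k a) (n : ℕ) : 0 < cfTail n a :=
  lt_of_le_of_lt (Nat.cast_nonneg _) (lt_cfTail ha n)

theorem app_add_length (b : List ℕ) (θ : ℕ → ℕ) (n : ℕ) : app b θ (n + b.length) = θ n := by
  simp [app]

theorem app_congr (b : List ℕ) {θ η : ℕ → ℕ} {n : ℕ} (h : ∀ i < n, θ i = η i) {i : ℕ}
    (hi : i < n + b.length) : app b θ i = app b η i := by
  unfold app
  split_ifs with h'
  · rfl
  · exact h _ (by omega)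

theorem Digits.app {k : ℕ} {b : List ℕ} (hb : ∀ d ∈ b, 1 ≤ d ∧ d ≤ k) {θ : ℕ → ℕ}
    (hθ : Digits k θ) : Digits k (app b θ) := by
  intro n
  unfold _root_.app
  split_ifs with h
  · exact hb _ (List.get_mem _ _)
  · exact hθ _

theorem cfVal_app_sub {k : ℕ} {b : List ℕ} (hb : ∀ d ∈ b, 1 ≤ d ∧ d ≤ k) (n : ℕ) {θ : ℕ → ℕ}
    (hθ : Digits k θ) :
    ∃ Q Q' ε : ℝ, 0 < Q ∧ 0 ≤ Q' ∧ (ε = 1 ∨ ε = -1) ∧ ∀ η ζ, Digits k η → Digits k ζ →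
      (∀ i < n, η i = θ i) → (∀ i < n, ζ i = θ i) →
      cfVal (app b η) - cfVal (app b ζ) = ε * ((cfTail n η - cfTail n ζ) /
        ((Q * cfTail n η + Q') * (Q * cfTail n ζ + Q'))) := by
  obtain ⟨P, P', Q, Q', hP, hP', hQ, hQ', hdet, h⟩ := exists_mobius (n + b.length) (hθ.app hb)
  have key : ∀ η, Digits k η → (∀ i < n, η i = θ i) →
      cfVal (app b η) = (P * cfTail n η + P') / (Q * cfTail n η + Q') := by
    intro η hη hηθ
    have h1 := h _ (hη.app hb) fun i hi => app_congr b hηθ hi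
    have e : (fun i => app b η (i + (n + b.length))) = fun i => η (i + n) := by
      funext i
      rw [← add_assoc, app_add_length]
    have e2 : cfVal (fun i => η (i + n)) = 1 / cfTail n η := by
      rw [cfVal_eq (hη.shift n), cfTail]
      simp only [zero_add, add_assoc, add_comm 1 n]
    have hy := cfTail_pos hη n
    rw [e, e2] at h1
    rw [h1]
    field_simp
  refine ⟨Q, Q', P * Q' - P' * Q, hQ, hQ', ?_, ?_⟩
  · rcases hdet with e | e
    · right; linear_combination -e
    · left; linear_combination -e
  · intro η ζ hη hζ h1 h2
    have hy := cfTail_pos hη n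
    have hz := cfTail_pos hζ n
    rw [key η hη h1, key ζ hζ h2]
    field_simp
    ring

/-- The words `θ` over `{1, …, m}` with `(θ 0, θ 1) ≠ (1, m)`. -/
def words (m : ℕ) : Set (ℕ → ℕ) := {θ | Digits m θ ∧ (θ 0, θ 1) ≠ (1, m)}

theorem Ctilk_eq_image (k : ℕ) (b : List ℕ) :
    Ctilk k b = (fun θ => cfVal (app b θ)) '' words (k - 1) := by
  ext x
  constructor
  · rintro ⟨θ, h1, h2, rfl⟩
    exact ⟨θ, ⟨h1, h2⟩, rfl⟩
  · rintro ⟨θ, ⟨h1, h2⟩, rfl⟩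
    exact ⟨θ, h1, h2, rfl⟩

/-- Keep the first `n` terms of `θ`, then put `d`, then `t`. -/
def splice (θ : ℕ → ℕ) (n d : ℕ) (t : ℕ → ℕ) : ℕ → ℕ := fun i =>
  if i < n then θ i else if i = n then d else t (i - (n + 1))

theorem splice_of_lt {θ : ℕ → ℕ} {n d : ℕ} {t : ℕ → ℕ} {i : ℕ} (h : i < n) :
    splice θ n d t i = θ i := by simp [splice, h]

theorem splice_self (θ : ℕ → ℕ) (n d : ℕ) (t : ℕ → ℕ) : splice θ n d t n = d := by simp [splice]

theorem splice_add (θ : ℕ → ℕ) (n d : ℕ) (t : ℕ → ℕ) (i : ℕ) :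
    splice θ n d t (i + (n + 1)) = t i := by
  simp [splice, show ¬ i + (n + 1) < n by omega, show ¬ i + (n + 1) = n by omega]

theorem cfTail_splice (θ : ℕ → ℕ) (n d : ℕ) (t : ℕ → ℕ) :
    cfTail n (splice θ n d t) = d + cfVal t := by
  simp only [cfTail, splice_self, splice_add]

theorem splice_mem_words {m : ℕ} {θ : ℕ → ℕ} (hθ : θ ∈ words m) {n d : ℕ} {t : ℕ → ℕ}
    (hd : 1 ≤ d ∧ d ≤ m) (ht : Digits m t) (h0 : n = 0 → (d, t 0) ≠ (1, m))
    (h1 : n = 1 → (θ 0, d) ≠ (1, m)) : splice θ n d t ∈ words m := by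
  refine ⟨fun i => ?_, ?_⟩
  · unfold splice
    split_ifs
    exacts [hθ.1 i, hd, ht _]
  · rcases n with _ | _ | n
    · simpa [splice] using h0 rfl
    · simpa [splice] using h1 rfl
    · simpa [splice] using hθ.2

/-- The periodic sequence `p, q, p, q, …`. -/
def alternating (p q : ℕ) : ℕ → ℕ := fun i => if i % 2 = 0 then p else q

theorem alternating_zero (p q : ℕ) : alternating p q 0 = p := rfl

theorem alternating_shift (p q : ℕ) : (fun i => alternating p q (i + 1)) = alternating q p := by
  funext i
  unfold alternating
  split_ifs <;> first | rfl | omega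

theorem digits_alternating {m p q : ℕ} (hp : 1 ≤ p ∧ p ≤ m) (hq : 1 ≤ q ∧ q ≤ m) :
    Digits m (alternating p q) := by
  intro i
  unfold alternating
  split_ifs
  exacts [hp, hq]

/-- The sequence `m - 1, 1, m, 1, m, …`. -/
def truncatedTail (m : ℕ) : ℕ → ℕ
  | 0 => m - 1
  | i + 1 => alternating 1 m i

theorem digits_truncatedTail {m : ℕ} (hm : 2 ≤ m) : Digits m (truncatedTail m) := by
  intro i
  cases i with
  | zero => simp only [truncatedTail]; omega
  | succ i => exact digits_alternating (by omega) (by omega) i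

theorem cfVal_bounds {m : ℕ} (hm : 4 ≤ m) :
    4 * cfVal (alternating m 1) ≤ cfVal (alternating 1 m) ∧
    1 ≤ cfVal (alternating 1 m) * (1 + cfVal (alternating 1 m) / 4) ∧
    cfVal (truncatedTail m) * (3 + cfVal (alternating 1 m)) ≤ 1 := by
  have hm' : (4 : ℝ) ≤ m := by exact_mod_cast hm
  have dω : Digits m (alternating 1 m) := digits_alternating (by omega) (by omega)
  have dα : Digits m (alternating m 1) := digits_alternating (by omega) (by omega)
  have eω := cfVal_eq dω
  have eα := cfVal_eq dα
  have eτ := cfVal_eq (digits_truncatedTail (by omega : 2 ≤ m))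
  have sτ : (fun i => truncatedTail m (i + 1)) = alternating 1 m := rfl
  have zτ : ((truncatedTail m 0 : ℕ) : ℝ) = m - 1 := by
    simp only [truncatedTail]
    push_cast [show 1 ≤ m by omega]
    ring
  rw [alternating_shift, alternating_zero] at eω eα
  rw [sτ, zτ] at eτ
  have pω := cfVal_pos dω
  have pα := cfVal_pos dα
  have pτ := cfVal_pos (digits_truncatedTail (by omega : 2 ≤ m))
  generalize cfVal (alternating 1 m) = ω at *
  generalize cfVal (alternating m 1) = α at *
  generalize cfVal (truncatedTail m) = τ at *
  rw [eq_div_iff (by positivity)] at eω eα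
  rw [eq_div_iff (by linarith)] at eτ
  push_cast at eω
  have h1 : 4 * α ≤ ω := by
    have : ω = m * α := by linear_combination eω - eα
    rw [this]
    exact mul_le_mul_of_nonneg_right hm' pα.le
  refine ⟨h1, ?_, ?_⟩
  · nlinarith
  · nlinarith

/-- Lower bounds for the lengths of the two cylinders next to a gap `(y₀, y₁)` in the coordinate
`y = 1/x`, after applying a Möbius map with pole `-Q'/Q`. -/
theorem bridge_estimates {ω α τ Q Q' j y₀ y₁ : ℝ} (hω : 0 < ω) (hω1 : ω < 1) (hτ : 0 < τ)
    (h1 : 4 * α ≤ ω) (h2 : 1 ≤ ω * (1 + ω / 4)) (h3 : τ * (3 + ω) ≤ 1) (hQ : 0 < Q)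
    (hQ' : 0 ≤ Q') (hj : 1 ≤ j) (hy₀ : j + ω ≤ y₀) (hy₁ : y₁ ≤ j + 1 + α) (hy : y₀ < y₁) :
    21 / 20 * ((y₁ - y₀) / ((Q * y₁ + Q') * (Q * y₀ + Q'))) ≤
      (y₀ - (j + τ)) / ((Q * y₀ + Q') * (Q * (j + τ) + Q')) ∧
    21 / 20 * ((y₁ - y₀) / ((Q * y₁ + Q') * (Q * y₀ + Q'))) ≤
      (j + 1 + ω - y₁) / ((Q * (j + 1 + ω) + Q') * (Q * y₁ + Q')) := by
  have hω8 : 0.828 ≤ ω := by nlinarith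
  have hτ' : τ ≤ 0.27 := by nlinarith
  have Y0 : 0 < Q * y₀ + Q' := by
    have : 0 < y₀ := by linarith
    positivity
  have Y1 : 0 < Q * y₁ + Q' := by
    have : 0 < y₁ := by linarith
    positivity
  have Yp : 0 < Q * (j + τ) + Q' := by positivity
  have Yq : 0 < Q * (j + 1 + ω) + Q' := by positivity
  have gap : y₁ - y₀ ≤ 1 - ω + α := by linarith
  constructor
  · rw [← mul_div_assoc, div_le_div_iff₀ (by positivity) (by positivity)]
    have a1 : 21 / 20 * (y₁ - y₀) ≤ y₀ - (j + τ) := by linarith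
    have a2 : Q * (j + τ) + Q' ≤ Q * y₁ + Q' := by
      have : j + τ ≤ y₁ := by linarith
      gcongr
    have a3 : 21 / 20 * (y₁ - y₀) * (Q * (j + τ) + Q') ≤ (y₀ - (j + τ)) * (Q * y₁ + Q') :=
      mul_le_mul a1 a2 Yp.le (by linarith)
    calc _ = 21 / 20 * (y₁ - y₀) * (Q * (j + τ) + Q') * (Q * y₀ + Q') := by ring
      _ ≤ (y₀ - (j + τ)) * (Q * y₁ + Q') * (Q * y₀ + Q') := by gcongr
      _ = _ := by ring
  · rw [← mul_div_assoc, div_le_div_iff₀ (by positivity) (by positivity)]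
    have a1 : 21 / 20 * (1 - ω + α) * (2 + ω) ≤ (ω - α) * (1 + ω) := by nlinarith
    have a2 : 21 / 20 * (1 - ω + α) ≤ ω - α := by linarith
    have R : 0 ≤ Q * (j - 1) + Q' := by
      have : 0 ≤ j - 1 := by linarith
      positivity
    have a3 : 21 / 20 * (1 - ω + α) * (Q * (j + 1 + ω) + Q') ≤
        (ω - α) * (Q * (j + ω) + Q') := by
      nlinarith [mul_le_mul_of_nonneg_left a1 hQ.le, mul_le_mul_of_nonneg_right a2 R]
    have a4 : 21 / 20 * (y₁ - y₀) * (Q * (j + 1 + ω) + Q') ≤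
        (j + 1 + ω - y₁) * (Q * y₀ + Q') :=
      calc _ ≤ 21 / 20 * (1 - ω + α) * (Q * (j + 1 + ω) + Q') := by gcongr
        _ ≤ (ω - α) * (Q * (j + ω) + Q') := a3
        _ ≤ _ := by
          refine mul_le_mul (by linarith) (by gcongr) ?_ (by linarith)
          have : 0 < j + ω := by linarith
          positivity
    calc _ = 21 / 20 * (y₁ - y₀) * (Q * (j + 1 + ω) + Q') * (Q * y₁ + Q') := by ring
      _ ≤ (j + 1 + ω - y₁) * (Q * y₀ + Q') * (Q * y₁ + Q') := by gcongr
      _ = _ := by ring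

theorem exists_bridges {m k : ℕ} (hm : 4 ≤ m) (hmk : m ≤ k) {b : List ℕ}
    (hb : ∀ d ∈ b, 1 ≤ d ∧ d ≤ k) {θ θ' : ℕ → ℕ} (hθ : θ ∈ words m) (hθ' : θ' ∈ words m) {n : ℕ}
    (hn : ∀ i < n, θ i = θ' i) (hlt : θ n < θ' n)
    (hgap : ∀ η ∈ words m, cfVal (app b η) ∉
      Ioo (cfVal (app b θ)) (cfVal (app b θ')) ∪ Ioo (cfVal (app b θ')) (cfVal (app b θ))) :
    ∃ p ∈ words m, ∃ q ∈ words m, (∀ i < n + 1, p i = θ i) ∧ (∀ i < n + 1, q i = θ' i) ∧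
      ∃ ε : ℝ, (ε = 1 ∨ ε = -1) ∧
        0 < ε * (cfVal (app b θ') - cfVal (app b θ)) ∧
        21 / 20 * (ε * (cfVal (app b θ') - cfVal (app b θ))) ≤
          ε * (cfVal (app b θ) - cfVal (app b p)) ∧
        21 / 20 * (ε * (cfVal (app b θ') - cfVal (app b θ))) ≤
          ε * (cfVal (app b q) - cfVal (app b θ')) := by
  obtain ⟨Q, Q', ε, hQ, hQ', hε, hN⟩ := cfVal_app_sub hb n (hθ.1.mono hmk)
  have hεε : ε * ε = 1 := by rcases hε with rfl | rfl <;> norm_num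
  have hN' : ∀ η ζ, η ∈ words m → ζ ∈ words m → (∀ i < n, η i = θ i) → (∀ i < n, ζ i = θ i) →
      ε * (cfVal (app b η) - cfVal (app b ζ)) = (cfTail n η - cfTail n ζ) /
        ((Q * cfTail n η + Q') * (Q * cfTail n ζ + Q')) := by
    intro η ζ hη hζ h1 h2
    rw [hN η ζ (hη.1.mono hmk) (hζ.1.mono hmk) h1 h2, ← mul_assoc, hεε, one_mul]
  have hmon : ∀ η ζ, η ∈ words m → ζ ∈ words m → (∀ i < n, η i = θ i) → (∀ i < n, ζ i = θ i) →
      cfTail n ζ < cfTail n η → 0 < ε * (cfVal (app b η) - cfVal (app b ζ)) := by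
    intro η ζ hη hζ h1 h2 h3
    have := cfTail_pos hη.1 n
    have := cfTail_pos hζ.1 n
    rw [hN' η ζ hη hζ h1 h2]
    exact div_pos (by linarith) (by positivity)
  have hrefl : ∀ i < n, θ i = θ i := fun _ _ => rfl
  have hn' : ∀ i < n, θ' i = θ i := fun i hi => (hn i hi).symm
  have hno : ∀ η ∈ words m, (∀ i < n, η i = θ i) →
      ¬ (cfTail n θ < cfTail n η ∧ cfTail n η < cfTail n θ') := by
    rintro η hη h1 ⟨h2, h3⟩
    have i1 := hmon η θ hη hθ h1 hrefl h2
    have i2 := hmon θ' η hθ' hη hn' h1 h3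
    refine hgap η hη ?_
    rcases hε with rfl | rfl
    · left; constructor <;> linarith
    · right; constructor <;> linarith
  have dω : Digits m (alternating 1 m) := digits_alternating (by omega) (by omega)
  have dα : Digits m (alternating m 1) := digits_alternating (by omega) (by omega)
  have dτ : Digits m (truncatedTail m) := digits_truncatedTail (by omega)
  have hθn := hθ.1 n
  have hθ'n := hθ'.1 n
  have hadj : θ' n = θ n + 1 := by
    by_contra hne
    have hmem : splice θ n (θ n + 1) (alternating 1 m) ∈ words m := by
      refine splice_mem_words hθ (by omega) dω ?_ ?_
      · intro _ h
        simp only [Prod.mk.injEq] at h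
        omega
      · intro _ h
        simp only [Prod.mk.injEq] at h
        omega
    refine hno _ hmem (fun i hi => splice_of_lt hi) ?_
    rw [cfTail_splice]
    have h1 := cfTail_lt hθ.1 n
    have h2 := lt_cfTail hθ'.1 n
    have h3 : (θ n : ℝ) + 2 ≤ θ' n := by exact_mod_cast (by omega : θ n + 2 ≤ θ' n)
    have h4 := cfVal_pos dω
    have h5 := cfVal_lt_one dω
    push_cast
    constructor <;> linarith
  have hlow : (θ n : ℝ) + cfVal (alternating 1 m) ≤ cfTail n θ := by
    by_contra! hc
    have hmem : splice θ n (θ n) (alternating 1 m) ∈ words m := by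
      refine splice_mem_words hθ hθn dω ?_ ?_
      · intro _ h
        simp only [Prod.mk.injEq, alternating_zero] at h
        omega
      · rintro rfl
        exact hθ.2
    refine hno _ hmem (fun i hi => splice_of_lt hi) ?_
    rw [cfTail_splice]
    have h2 := lt_cfTail hθ'.1 n
    have h5 := cfVal_lt_one dω
    rw [hadj] at h2
    push_cast at h2
    exact ⟨hc, by linarith⟩
  have hhigh : cfTail n θ' ≤ θ n + 1 + cfVal (alternating m 1) := by
    by_contra! hc
    have hmem : splice θ' n (θ' n) (alternating m 1) ∈ words m := by
      refine splice_mem_words hθ' hθ'n dα ?_ ?_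
      · intro _ h
        simp only [Prod.mk.injEq] at h
        omega
      · rintro rfl
        exact hθ'.2
    refine hno _ hmem (fun i hi => (splice_of_lt hi).trans (hn' i hi)) ?_
    rw [cfTail_splice, hadj]
    have h2 := cfTail_lt hθ.1 n
    have h5 := cfVal_pos dα
    push_cast
    exact ⟨by linarith, hc⟩
  have hp : splice θ n (θ n) (truncatedTail m) ∈ words m := by
    refine splice_mem_words hθ hθn dτ ?_ ?_
    · intro _ h
      simp only [Prod.mk.injEq, truncatedTail] at h
      omega
    · rintro rfl
      exact hθ.2
  have hq : splice θ' n (θ' n) (alternating 1 m) ∈ words m := by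
    refine splice_mem_words hθ' hθ'n dω ?_ ?_
    · intro _ h
      simp only [Prod.mk.injEq] at h
      omega
    · rintro rfl
      exact hθ'.2
  have hlt' : cfTail n θ < cfTail n θ' := by
    have h1 := cfTail_lt hθ.1 n
    have h2 := lt_cfTail hθ'.1 n
    rw [hadj] at h2
    push_cast at h2
    linarith
  have agree : ∀ (ζ t : ℕ → ℕ), ∀ i < n + 1, splice ζ n (ζ n) t i = ζ i := by
    intro ζ t i hi
    rcases Nat.lt_succ_iff_lt_or_eq.1 hi with h | rfl
    · exact splice_of_lt h
    · exact splice_self _ _ _ _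
  obtain ⟨b1, b2, b3⟩ := cfVal_bounds hm
  obtain ⟨e1, e2⟩ := bridge_estimates (cfVal_pos dω) (cfVal_lt_one dω)
    (cfVal_pos dτ) b1 b2 b3 hQ hQ' (hθ.1.one_le_cast n) hlow hhigh hlt'
  refine ⟨_, hp, _, hq, agree _ _, agree _ _, ε, hε, hmon θ' θ hθ' hθ hn' hrefl hlt', ?_, ?_⟩
  · rw [hN' θ' θ hθ' hθ hn' hrefl, hN' θ _ hθ hp hrefl fun i hi => splice_of_lt hi, cfTail_splice]
    exact e1
  · rw [hN' θ' θ hθ' hθ hn' hrefl,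
      hN' _ θ' hq hθ' (fun i hi => (splice_of_lt hi).trans (hn' i hi)) hn', cfTail_splice, hadj]
    push_cast
    exact e2

theorem exists_first_diff {θ η : ℕ → ℕ} (h : θ ≠ η) : ∃ n, (∀ i < n, θ i = η i) ∧ θ n ≠ η n := by
  classical
  have hex : ∃ n, θ n ≠ η n := Function.ne_iff.1 h
  exact ⟨Nat.find hex, fun i hi => not_not.1 (Nat.find_min hex hi), Nat.find_spec hex⟩

/-- The value map is monotone or antitone on each cylinder, with respect to the next digit. -/
theorem exists_sign {k : ℕ} {b : List ℕ} (hb : ∀ d ∈ b, 1 ≤ d ∧ d ≤ k) (n : ℕ) {θ : ℕ → ℕ}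
    (hθ : Digits k θ) :
    ∃ ε : ℝ, (ε = 1 ∨ ε = -1) ∧ ∀ η ζ, Digits k η → Digits k ζ → (∀ i < n, η i = θ i) →
      (∀ i < n, ζ i = θ i) → ζ n < η n → 0 < ε * (cfVal (app b η) - cfVal (app b ζ)) := by
  obtain ⟨Q, Q', ε, hQ, hQ', hε, hN⟩ := cfVal_app_sub hb n hθ
  refine ⟨ε, hε, fun η ζ hη hζ h1 h2 h3 => ?_⟩
  have hεε : ε * ε = 1 := by rcases hε with rfl | rfl <;> norm_num
  rw [hN η ζ hη hζ h1 h2, ← mul_assoc, hεε, one_mul]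
  have h4 := cfTail_pos hη n
  have h5 := cfTail_pos hζ n
  have h6 := lt_cfTail hη n
  have h7 := cfTail_lt hζ n
  have h8 : (ζ n : ℝ) + 1 ≤ η n := by exact_mod_cast h3
  exact div_pos (by linarith) (by positivity)

theorem cfVal_app_injOn {k : ℕ} {b : List ℕ} (hb : ∀ d ∈ b, 1 ≤ d ∧ d ≤ k) {θ η : ℕ → ℕ}
    (hθ : Digits k θ) (hη : Digits k η) (h : cfVal (app b θ) = cfVal (app b η)) : θ = η := by
  by_contra hne
  obtain ⟨n, hn, hne⟩ := exists_first_diff hne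
  obtain ⟨ε, -, hε⟩ := exists_sign hb n hθ
  rcases lt_or_gt_of_ne hne with hl | hl
  · have := hε η θ hη hθ (fun i hi => (hn i hi).symm) (fun _ _ => rfl) hl
    simp [h] at this
  · have := hε θ η hθ hη (fun _ _ => rfl) (fun i hi => (hn i hi).symm) hl
    simp [h] at this

/-- Cylinders are order-convex. -/
theorem agree_of_between {k : ℕ} {b : List ℕ} (hb : ∀ d ∈ b, 1 ≤ d ∧ d ≤ k) {x y z : ℕ → ℕ}
    (hx : Digits k x) (hy : Digits k y) (hz : Digits k z) {n : ℕ} (hxy : ∀ i < n, x i = y i)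
    (h1 : cfVal (app b x) ≤ cfVal (app b z)) (h2 : cfVal (app b z) ≤ cfVal (app b y)) :
    ∀ i < n, z i = x i := by
  by_contra! hc
  obtain ⟨i₀, hi₀, hne₀⟩ := hc
  obtain ⟨l, hl, hne⟩ := exists_first_diff (θ := z) (η := x) fun h => hne₀ (by rw [h])
  have hln : l < n := by
    by_contra! h
    exact hne₀ (hl i₀ (by omega))
  have hly : ∀ i < l, y i = x i := fun i hi => (hxy i (by omega)).symm
  obtain ⟨ε, hε, hs⟩ := exists_sign hb l hx
  rcases lt_or_gt_of_ne hne with h | h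
  · have i1 := hs x z hx hz (fun _ _ => rfl) hl h
    have i2 := hs y z hy hz hly hl (by rw [← hxy l hln]; exact h)
    rcases hε with rfl | rfl <;> linarith
  · have i1 := hs z x hz hx hl (fun _ _ => rfl) h
    have i2 := hs z y hz hy hl hly (by rw [← hxy l hln]; exact h)
    rcases hε with rfl | rfl <;> linarith

theorem IsGap.exists_bridges {m k : ℕ} (hm : 4 ≤ m) (hmk : m ≤ k) {b : List ℕ}
    (hb : ∀ d ∈ b, 1 ≤ d ∧ d ≤ k) {u v : ℝ}
    (h : IsGap ((fun θ => cfVal (app b θ)) '' words m) u v) :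
    ∃ θ ∈ words m, ∃ θ' ∈ words m, cfVal (app b θ) = u ∧ cfVal (app b θ') = v ∧
      ∃ n, θ n ≠ θ' n ∧ ∃ p ∈ words m, ∃ q ∈ words m,
        (∀ i < n + 1, p i = θ i) ∧ (∀ i < n + 1, q i = θ' i) ∧
        21 / 20 * (v - u) ≤ u - cfVal (app b p) ∧ 21 / 20 * (v - u) ≤ cfVal (app b q) - v := by
  obtain ⟨huv, ⟨θ, hθ, rfl⟩, ⟨θ', hθ', rfl⟩, hK⟩ := h
  simp only at huv hK
  have hno : ∀ η ∈ words m, cfVal (app b η) ∉ Ioo (cfVal (app b θ)) (cfVal (app b θ')) :=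
    fun η hη hi => (hK ▸ ⟨hi, η, hη, rfl⟩ : cfVal (app b η) ∈ (∅ : Set ℝ))
  have hempty : Ioo (cfVal (app b θ')) (cfVal (app b θ)) = ∅ := Ioo_eq_empty (by linarith)
  obtain ⟨n, hn, hne⟩ := exists_first_diff (θ := θ) (η := θ') fun h => by simp [h] at huv
  refine ⟨θ, hθ, θ', hθ', rfl, rfl, n, hne, ?_⟩
  rcases lt_or_gt_of_ne hne with hl | hl
  · obtain ⟨p, hp, q, hq, h1, h2, ε, hε, h3, h4, h5⟩ :=
      _root_.exists_bridges hm hmk hb hθ hθ' hn hl (by rw [hempty, union_empty]; exact hno)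
    refine ⟨p, hp, q, hq, h1, h2, ?_⟩
    rcases hε with rfl | rfl
    · constructor <;> linarith
    · linarith
  · obtain ⟨p, hp, q, hq, h1, h2, ε, hε, h3, h4, h5⟩ :=
      _root_.exists_bridges hm hmk hb hθ' hθ (fun i hi => (hn i hi).symm) hl
        (by rw [hempty, empty_union]; exact hno)
    refine ⟨q, hq, p, hp, h2, h1, ?_⟩
    rcases hε with rfl | rfl
    · linarith
    · constructor <;> linarith

theorem gap_separation {m k : ℕ} (hm : 4 ≤ m) (hmk : m ≤ k) {b : List ℕ}
    (hb : ∀ d ∈ b, 1 ≤ d ∧ d ≤ k) {u v u' v' : ℝ}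
    (h : IsGap ((fun θ => cfVal (app b θ)) '' words m) u v)
    (h' : IsGap ((fun θ => cfVal (app b θ)) '' words m) u' v') (hvu : v ≤ u') :
    21 / 20 * min (v - u) (v' - u') ≤ u' - v := by
  have hK := h.2.2.2
  have hK' := h'.2.2.2
  have huv := h.1
  have huv' := h'.1
  obtain ⟨x, hx, y, hy, rfl, rfl, n, hne, p, hp, q, hq, h1, h2, h3, h4⟩ :=
    h.exists_bridges hm hmk hb
  obtain ⟨x', hx', y', hy', rfl, rfl, n', hne', p', hp', q', hq', h1', h2', h3', h4'⟩ :=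
    h'.exists_bridges hm hmk hb
  by_contra! hc
  have c1 := min_le_left (cfVal (app b y) - cfVal (app b x)) (cfVal (app b y') - cfVal (app b x'))
  have c2 := min_le_right (cfVal (app b y) - cfVal (app b x)) (cfVal (app b y') - cfVal (app b x'))
  have hq1 : cfVal (app b y') ≤ cfVal (app b q) := by
    by_contra! hlt
    exact (hK' ▸ ⟨⟨by linarith, hlt⟩, q, hq, rfl⟩ : cfVal (app b q) ∈ (∅ : Set ℝ))
  have hp1 : cfVal (app b p') ≤ cfVal (app b x) := by
    by_contra! hlt
    exact (hK ▸ ⟨⟨hlt, by linarith⟩, p', hp', rfl⟩ : cfVal (app b p') ∈ (∅ : Set ℝ))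
  have D : ∀ {z}, z ∈ words m → Digits k z := fun hz => hz.1.mono hmk
  have a1 := agree_of_between hb (D hy) (D hq) (D hx') (fun i hi => (h2 i hi).symm) hvu
    (by linarith)
  have a2 := agree_of_between hb (D hy) (D hq) (D hy') (fun i hi => (h2 i hi).symm)
    (by linarith) hq1
  have a3 := agree_of_between hb (D hp') (D hx') (D hx) h1' hp1 (by linarith)
  have a4 := agree_of_between hb (D hp') (D hx') (D hy) h1' (by linarith) hvu
  rcases le_total n n' with hnn | hnn
  · exact hne ((a3 n (by omega)).trans (a4 n (by omega)).symm)
  · exact hne' ((a1 n' (by omega)).trans (a2 n' (by omega)).symm)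

theorem isCompact_words (m : ℕ) : IsCompact (words m) := by
  have h1 : IsCompact (Set.pi univ fun _ : ℕ => Icc 1 m) :=
    isCompact_univ_pi fun _ => (finite_Icc 1 m).isCompact
  have hcont : Continuous fun θ : ℕ → ℕ => (θ 0, θ 1) := by fun_prop
  have h2 : IsClosed {θ : ℕ → ℕ | (θ 0, θ 1) ≠ (1, m)} :=
    (isClosed_discrete {q : ℕ × ℕ | q ≠ (1, m)}).preimage hcont
  convert h1.inter_right h2 using 1
  ext θ
  simp only [words, Digits, mem_ofPred_eq, mem_inter_iff, mem_univ_pi, mem_Icc]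

theorem continuousOn_cfVal_app {k : ℕ} {b : List ℕ} (hb : ∀ d ∈ b, 1 ≤ d ∧ d ≤ k) :
    ContinuousOn (fun θ => cfVal (app b θ)) {θ | Digits k θ} := by
  intro θ hθ
  rw [ContinuousWithinAt, Metric.tendsto_nhds]
  intro ε hε
  obtain ⟨n, hn⟩ := exists_pow_lt_of_lt_one hε (contr_lt_one k)
  have hnhds : ∀ᶠ η in nhds θ, ∀ i ∈ Finset.range n, η i = θ i := by
    rw [Filter.eventually_all_finset]
    intro i _
    have hc : ContinuousAt (fun η : ℕ → ℕ => η i) θ := (continuous_apply i).continuousAt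
    exact hc.eventually_mem ((isOpen_discrete {θ i}).mem_nhds rfl)
  filter_upwards [mem_nhdsWithin_of_mem_nhds hnhds, self_mem_nhdsWithin] with η hη hηd
  rw [Real.dist_eq]
  refine lt_of_le_of_lt (abs_cfVal_sub_le n (Digits.app hb hηd) (Digits.app hb hθ) ?_) hn
  intro i hi
  exact app_congr b (n := n) (fun j hj => hη j (Finset.mem_range.2 hj)) (by omega)

theorem isCantorSet_image {m k : ℕ} (hm : 2 ≤ m) (hmk : m ≤ k) {b : List ℕ}
    (hb : ∀ d ∈ b, 1 ≤ d ∧ d ≤ k) : IsCantorSet ((fun θ => cfVal (app b θ)) '' words m) := by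
  have hsub : words m ⊆ {θ | Digits k θ} := fun θ hθ => hθ.1.mono hmk
  have hcont : ContinuousOn (fun θ => cfVal (app b θ)) (words m) :=
    (continuousOn_cfVal_app hb).mono hsub
  have hcomp := (isCompact_words m).image_of_continuousOn hcont
  refine ⟨hcomp, ⟨hcomp.isClosed, ?_⟩, ?_⟩
  · rintro _ ⟨θ, hθ, rfl⟩
    set η : ℕ → ℕ → ℕ := fun n =>
      Function.update θ (n + 2) (if θ (n + 2) = 1 then 2 else 1) with hη
    have hmem : ∀ n, η n ∈ words m := by
      intro n
      refine ⟨fun i => ?_, ?_⟩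
      · by_cases hi : i = n + 2
        · subst hi
          simp only [hη, Function.update_self]
          split_ifs <;> omega
        · simp only [hη, Function.update_of_ne hi]
          exact hθ.1 i
      · simpa [hη] using hθ.2
    have hne : ∀ n, cfVal (app b (η n)) ≠ cfVal (app b θ) := by
      intro n h
      have h1 := congrFun (cfVal_app_injOn hb (hsub (hmem n)) (hsub hθ) h) (n + 2)
      simp only [hη, Function.update_self] at h1
      split_ifs at h1 <;> omega
    have hlim : Tendsto η atTop (nhds θ) := by
      rw [tendsto_pi_nhds]
      intro i
      refine tendsto_const_nhds.congr' ?_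
      filter_upwards [eventually_ge_atTop i] with n hn
      simp only [hη]
      rw [Function.update_of_ne (by omega)]
    have hlim' : Tendsto (fun n => cfVal (app b (η n))) atTop (nhds (cfVal (app b θ))) :=
      (hcont θ hθ).tendsto.comp
        (tendsto_nhdsWithin_iff.2 ⟨hlim, Eventually.of_forall hmem⟩)
    rw [accPt_iff_frequently]
    exact hlim'.frequently (Frequently.of_forall fun n => ⟨hne n, η n, hmem n, rfl⟩)
  · have : CompactSpace (words m) := isCompact_iff_compactSpace.1 (isCompact_words m)
    have hinj : Function.Injective ((words m).domRestrict fun θ => cfVal (app b θ)) :=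
      fun x y h => Subtype.ext (cfVal_app_injOn hb (hsub x.2) (hsub y.2) h)
    have hemb := (continuousOn_iff_continuous_domRestrict.1 hcont).isClosedEmbedding hinj
    rw [← range_domRestrict]
    exact hemb.isEmbedding.isTotallyDisconnected_range.2 inferInstance

theorem IsCantorSet.exists_isGap {K : Set ℝ} (hK : IsCantorSet K) {p q : ℝ} (hp : p ∈ K)
    (hq : q ∈ K) (hpq : p < q) : ∃ u v, IsGap K u v := by
  obtain ⟨hc, -, ht⟩ := hK
  obtain ⟨z, hz, hzK⟩ : ∃ z ∈ Icc p q, z ∉ K := by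
    by_contra! h
    exact hpq.ne (ht _ h isPreconnected_Icc ⟨le_rfl, hpq.le⟩ ⟨hpq.le, le_rfl⟩)
  have cu : IsCompact (K ∩ Iic z) := hc.inter_right isClosed_Iic
  have cv : IsCompact (K ∩ Ici z) := hc.inter_right isClosed_Ici
  have mu := cu.sSup_mem ⟨p, hp, hz.1⟩
  have mv := cv.sInf_mem ⟨q, hq, hz.2⟩
  refine ⟨_, _, ?_, mu.1, mv.1, ?_⟩
  · have h1 : sSup (K ∩ Iic z) ≠ z := fun h => hzK (h ▸ mu.1)
    exact lt_of_lt_of_le (lt_of_le_of_ne mu.2 h1) mv.2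
  · refine eq_empty_iff_forall_notMem.2 fun x ⟨hx, hxK⟩ => ?_
    rcases le_total x z with h | h
    · exact absurd (le_csSup cu.bddAbove ⟨hxK, h⟩) (not_le.2 hx.1)
    · exact absurd (csInf_le cv.bddBelow ⟨hxK, h⟩) (not_le.2 hx.2)

theorem le_thickness_image {m k : ℕ} (hm : 4 ≤ m) (hmk : m ≤ k) {b : List ℕ}
    (hb : ∀ d ∈ b, 1 ≤ d ∧ d ≤ k) :
    21 / 20 ≤ thickness ((fun θ => cfVal (app b θ)) '' words m) := by
  have hC := isCantorSet_image (by omega : 2 ≤ m) hmk hb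
  have hsub : words m ⊆ {θ | Digits k θ} := fun θ hθ => hθ.1.mono hmk
  have hbase : ∀ d, 1 ≤ d → d ≤ 2 → (fun _ => d) ∈ words m := fun d h1 h2 =>
    ⟨fun _ => ⟨h1, h2.trans (by omega)⟩, fun h => by simp only [Prod.mk.injEq] at h; omega⟩
  have hne : cfVal (app b fun _ => 1) ≠ cfVal (app b fun _ => 2) := fun h => by
    have := congrFun (cfVal_app_injOn hb (hsub (hbase 1 le_rfl (by norm_num)))
      (hsub (hbase 2 (by norm_num) le_rfl)) h) 0
    norm_num at this
  have hgap : ∃ u v, IsGap ((fun θ => cfVal (app b θ)) '' words m) u v := by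
    rcases lt_or_gt_of_ne hne with h | h
    · exact hC.exists_isGap ⟨_, hbase 1 le_rfl (by norm_num), rfl⟩
        ⟨_, hbase 2 (by norm_num) le_rfl, rfl⟩ h
    · exact hC.exists_isGap ⟨_, hbase 2 (by norm_num) le_rfl, rfl⟩
        ⟨_, hbase 1 le_rfl (by norm_num), rfl⟩ h
  obtain ⟨u₀, v₀, h₀⟩ := hgap
  refine le_csInf ⟨_, u₀, v₀, h₀, rfl⟩ ?_
  rintro _ ⟨u, v, h, rfl⟩
  obtain ⟨x, -, y, -, -, -, -, -, p, hp, q, hq, -, -, h3, h4⟩ := h.exists_bridges hm hmk hb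
  rw [le_div_iff₀ (sub_pos.2 h.1), le_min_iff]
  constructor
  · rw [leftBridgeLen, le_sub_comm]
    refine csSup_le ⟨_, Or.inl rfl⟩ ?_
    rintro d (rfl | ⟨c, hg, hd, hl⟩)
    · exact (csInf_le hC.1.bddBelow ⟨p, hp, rfl⟩).trans (by linarith)
    · have := gap_separation hm hmk hb hg h hd
      rw [min_eq_right hl] at this
      linarith
  · rw [rightBridgeLen, le_sub_iff_add_le]
    refine le_csInf ⟨_, Or.inl rfl⟩ ?_
    rintro c (rfl | ⟨d, hg, hd, hl⟩)
    · exact le_trans (by linarith) (le_csSup hC.1.bddAbove ⟨q, hq, rfl⟩)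
    · have := gap_separation hm hmk hb h hg hd
      rw [min_eq_left hl] at this
      linarith

theorem digits_betaW {k : ℕ} (hk : 1 ≤ k) (s : ℕ) : ∀ d ∈ betaW k s, 1 ≤ d ∧ d ≤ k := by
  intro d hd
  simp only [betaW, List.mem_flatten, List.mem_replicate] at hd
  obtain ⟨l, ⟨-, rfl⟩, hd⟩ := hd
  simp only [List.mem_cons, List.not_mem_nil, or_false] at hd
  omega

/-- For every integer `k ≥ 5` and every `s ≥ 0`, the set `C̃_k(β^s)` is a Cantor set
of thickness greater than `1`. -/
theorem Ctilk_thickness (k : ℕ) (hk : 5 ≤ k) (s : ℕ) :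
    IsCantorSet (Ctilk k (betaW k s)) ∧ 1 < thickness (Ctilk k (betaW k s)) := by
  have hb := digits_betaW (by omega : 1 ≤ k) s
  rw [Ctilk_eq_image]
  exact ⟨isCantorSet_image (by omega) (Nat.sub_le k 1) hb,
    lt_of_lt_of_le (by norm_num) (le_thickness_image (by omega) (Nat.sub_le k 1) hb)⟩
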